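/- arXiv:1806.06726 — 3 statements merged into one kernel-verified Lean document; each statement's English description precedes it below -/
import Mathlib

section
/- Let T be a zip tree on a finite set of nodes with distinct keys, let x be a node of T, and let y be a node of T with key(y) > key(x). Then y is an ancestor of x if and only if rank(y) > rank(z) for every node z of T with key(x) ≤ key(z) < key(y). -/
open scoped ENNReal

/-- A binary tree whose nodes carry a key of type `α` and a natural-number rank. -/
inductive ZTree (α : Type) : Type where
  | leaf : ZTree α
  | node (left : ZTree α) (key : α) (rank : ℕ) (right : ZTree α) : ZTree α

namespace ZTree
variable {α : Type} [LinearOrder α]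

/-- The list of (key, rank) pairs of the nodes of the tree, in symmetric order. -/
def nodes : ZTree α → List (α × ℕ)
  | .leaf => []
  | .node l k rk r => l.nodes ++ (k, rk) :: r.nodes

/-- Binary-search-tree (symmetric order) property. -/
def isBST : ZTree α → Prop
  | .leaf => True
  | .node l k _ r =>
      (∀ p ∈ l.nodes, p.1 < k) ∧ (∀ p ∈ r.nodes, k < p.1) ∧ l.isBST ∧ r.isBST

/-- The rank of the root node, if any. -/
def rootRank? : ZTree α → Option ℕ
  | .leaf => none
  | .node _ _ rk _ => some rk

/-- Max-heap order on ranks, ties broken in favor of smaller keys: every node's rank is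
strictly greater than that of its left child and at least that of its right child. -/
def isRankHeap : ZTree α → Prop
  | .leaf => True
  | .node l _ rk r =>
      (∀ m ∈ l.rootRank?, m < rk) ∧ (∀ m ∈ r.rootRank?, m ≤ rk) ∧
        l.isRankHeap ∧ r.isRankHeap

/-- The zip-tree conditions: symmetric order on keys and heap order on ranks. -/
def isZipTree (t : ZTree α) : Prop := t.isBST ∧ t.isRankHeap

/-- The (key, rank) pairs on the search path from the root to the node with key `a`. -/
def pathTo (a : α) : ZTree α → List (α × ℕ)
  | .leaf => []
  | .node l k rk r =>
      if a < k then (k, rk) :: l.pathTo a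
      else if k < a then (k, rk) :: r.pathTo a
      else [(k, rk)]

/-- The depth (number of edges from the root) of the node with key `a`. -/
def depth (a : α) : ZTree α → ℕ
  | .leaf => 0
  | .node l k _ r =>
      if a < k then l.depth a + 1
      else if k < a then r.depth a + 1
      else 0

/-- The subtree rooted at the node with key `a`. -/
def subtreeAt (a : α) : ZTree α → ZTree α
  | .leaf => .leaf
  | .node l k rk r =>
      if a < k then l.subtreeAt a
      else if k < a then r.subtreeAt a
      else .node l k rk r

/-- Number of nodes on the left spine (root through left children). -/
def leftSpineLen : ZTree α → ℕ
  | .leaf => 0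
  | .node l _ _ _ => l.leftSpineLen + 1

/-- Number of nodes on the right spine (root through right children). -/
def rightSpineLen : ZTree α → ℕ
  | .leaf => 0
  | .node _ _ _ r => r.rightSpineLen + 1

/-- Total number of nodes on the right spine of the left subtree of the node with key `a`
together with the left spine of its right subtree: the paths zipped when deleting this
node, equivalently, the path unzipped when inserting it. -/
def zipSpineCount (a : α) (t : ZTree α) : ℕ :=
  match t.subtreeAt a with
  | .leaf => 0
  | .node l _ _ r => l.rightSpineLen + r.leftSpineLen

end ZTree

namespace ZTree

theorem isRankHeap.rank_le_of_rootRank?_le {α : Type} {t : ZTree α} (ht : t.isRankHeap) {n : ℕ}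
    (hn : ∀ m ∈ t.rootRank?, m ≤ n) : ∀ p ∈ t.nodes, p.2 ≤ n := by
  induction t with
  | leaf => simp [nodes]
  | node l k rk r ihl ihr =>
    obtain ⟨hl, hr, hhl, hhr⟩ := ht
    have hrk : rk ≤ n := hn rk rfl
    intro p hp
    simp only [nodes, List.mem_append, List.mem_cons] at hp
    rcases hp with hp | rfl | hp
    · exact ihl hhl (fun m hm => (hl m hm).le.trans hrk) p hp
    · exact hrk
    · exact ihr hhr (fun m hm => (hr m hm).trans hrk) p hp

theorem isRankHeap.rank_lt_of_rootRank?_lt {α : Type} {t : ZTree α} (ht : t.isRankHeap) {n : ℕ}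
    (hn : ∀ m ∈ t.rootRank?, m < n) : ∀ p ∈ t.nodes, p.2 < n := by
  cases t with
  | leaf => simp [nodes]
  | node l k rk r =>
    have hrk : rk < n := hn rk rfl
    intro p hp
    refine (ht.rank_le_of_rootRank?_le (n := rk) ?_ p hp).trans_lt hrk
    simp [rootRank?]

variable {α : Type} [LinearOrder α]

theorem mem_nodes_of_mem_pathTo {a : α} {p : α × ℕ} {t : ZTree α} (hp : p ∈ t.pathTo a) :
    p ∈ t.nodes := by
  induction t with
  | leaf => exact hp
  | node l k rk r ihl ihr =>
    simp only [pathTo] at hp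
    simp only [nodes, List.mem_append, List.mem_cons]
    split_ifs at hp <;> simp only [List.mem_cons, List.not_mem_nil, or_false] at hp <;> tauto

theorem isZipTree.mem_pathTo_iff_of_lt {t : ZTree α} (ht : t.isZipTree) {x y : α × ℕ}
    (hx : x ∈ t.nodes) (hy : y ∈ t.nodes) (hkey : x.1 < y.1) :
    y ∈ t.pathTo x.1 ↔ ∀ z ∈ t.nodes, x.1 ≤ z.1 → z.1 < y.1 → z.2 < y.2 := by
  induction t with
  | leaf => simp [nodes] at hx
  | node l k rk r ihl ihr =>
    obtain ⟨⟨hl, hr, hbl, hbr⟩, hml, hmr, hhl, hhr⟩ := ht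
    have hlt := hhl.rank_lt_of_rootRank?_lt hml
    have hle := hhr.rank_le_of_rootRank?_le hmr
    simp only [nodes, List.mem_append, List.mem_cons] at hx hy ⊢
    simp only [pathTo]
    rcases hx with hx | rfl | hx
    · have hxk := hl x hx
      rw [if_pos hxk, List.mem_cons]
      rcases hy with hy | rfl | hy
      · have hyk := hl y hy
        rw [or_iff_right (by rintro rfl; exact hyk.false), ihl ⟨hbl, hhl⟩ hx hy]
        refine ⟨?_, fun h z hz => h z (.inl hz)⟩
        rintro h z (hz | rfl | hz) hxz hzy
        · exact h z hz hxz hzy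
        · exact absurd hzy hyk.not_gt
        · exact absurd hzy (hyk.trans (hr z hz)).not_gt
      · refine iff_of_true (.inl rfl) ?_
        rintro z (hz | rfl | hz) - hzy
        · exact hlt z hz
        · exact absurd hzy (lt_irrefl _)
        · exact absurd hzy (hr z hz).not_gt
      · have hyk := hr y hy
        refine iff_of_false ?_ fun h =>
          (h (k, rk) (.inr (.inl rfl)) hxk.le hyk).not_ge (hle y hy)
        rintro (rfl | h)
        · exact hyk.false
        · exact hyk.not_gt (hl y (mem_nodes_of_mem_pathTo h))
    · have hyr : y ∈ r.nodes := by
        rcases hy with hy | rfl | hy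
        · exact absurd hkey (hl y hy).not_gt
        · exact absurd hkey (lt_irrefl _)
        · exact hy
      rw [if_neg (lt_irrefl _), if_neg (lt_irrefl _), List.mem_singleton]
      refine iff_of_false (by rintro rfl; exact hkey.false) fun h =>
        (h (k, rk) (.inr (.inl rfl)) le_rfl hkey).not_ge (hle y hyr)
    · have hxk := hr x hx
      have hyk := hxk.trans hkey
      have hyr : y ∈ r.nodes := by
        rcases hy with hy | rfl | hy
        · exact absurd hyk (hl y hy).not_gt
        · exact absurd hyk (lt_irrefl _)
        · exact hy
      rw [if_neg hxk.not_gt, if_pos hxk, List.mem_cons,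
        or_iff_right (by rintro rfl; exact hyk.false), ihr ⟨hbr, hhr⟩ hx hyr]
      refine ⟨?_, fun h z hz => h z (.inr (.inr hz))⟩
      rintro h z (hz | rfl | hz) hxz hzy
      · exact absurd hxz (not_le.2 ((hl z hz).trans hxk))
      · exact absurd hxz (not_le.2 hxk)
      · exact h z hz hxz hzy

end ZTree

/-- **Characterization of high ancestors.** Let `T` be a zip tree with distinct keys,
let `x` be a node of `T`, and let `y` be a node of `T` with `key y > key x`. Then `y`
is an ancestor of `x` (i.e. `y` lies on the search path from the root to `x`) if and
only if `rank y > rank z` for every node `z` of `T` with `key x ≤ key z < key y`. -/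
theorem high_ancestor_iff {α : Type} [LinearOrder α] (T : ZTree α)
    (hT : T.isZipTree) (hd : (T.nodes.map Prod.fst).Nodup)
    (x y : α × ℕ) (hx : x ∈ T.nodes) (hy : y ∈ T.nodes) (hkey : x.1 < y.1) :
    y ∈ T.pathTo x.1 ↔ ∀ z ∈ T.nodes, x.1 ≤ z.1 → z.1 < y.1 → z.2 < y.2 := by
  exact hT.mem_pathTo_iff_of_lt hx hy hkey
end

section
/- Let r : Fin n → ℕ be a family of independent random variables, each geometrically distributed with P(r(i) = k) = 1/2^{k+1}, and suppose n ≥ 2. For every index i, the expected number of indices j ≤ i such that r(j) ≥ r(z) for all z with j ≤ z ≤ i is at most lg n + 3. -/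
open scoped ENNReal

theorem ENNReal.tsum_pi_prod {α : Type*} (n : ℕ) (g : Fin n → α → ℝ≥0∞) :
    ∑' f : Fin n → α, ∏ j, g j (f j) = ∏ j, ∑' k, g j k := by
  induction n with
  | zero => simp
  | succ n ih =>
    rw [← (Fin.consEquiv fun _ => α).tsum_eq, ENNReal.tsum_prod', Fin.prod_univ_succ,
      ← ih, ← ENNReal.tsum_mul_right]
    refine tsum_congr fun a => ?_
    rw [← ENNReal.tsum_mul_left]
    refine tsum_congr fun f => ?_
    simp [Fin.prod_univ_succ, Fin.consEquiv]

theorem half_pow_add_sum_range (k : ℕ) :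
    (1 / 2 : ℝ≥0∞) ^ k + ∑ x ∈ Finset.range k, (1 / 2 : ℝ≥0∞) ^ (x + 1) = 1 := by
  induction k with
  | zero => simp
  | succ k ih =>
    rw [Finset.sum_range_succ, add_comm (Finset.sum _ _), ← add_assoc, ← two_mul, pow_succ',
      ← mul_assoc, one_div, ENNReal.mul_inv_cancel (by simp) (by simp), one_mul]
    simpa using ih

theorem tsum_half_pow_succ : ∑' x : ℕ, (1 / 2 : ℝ≥0∞) ^ (x + 1) = 1 := by
  rw [ENNReal.tsum_geometric_add_one, one_div, ENNReal.one_sub_inv_two, inv_inv,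
    ENNReal.inv_mul_cancel (by simp) (by simp)]

theorem mul_sum_pow_add_pow {R : Type*} [CommSemiring R] {q s : R} (h : q + s = 1) (m : ℕ) :
    q * ∑ t ∈ Finset.range m, s ^ t + s ^ m = 1 := by
  induction m with
  | zero => simp
  | succ m ih =>
    rw [Finset.sum_range_succ, mul_add, add_assoc, pow_succ', ← add_mul, h, one_mul, ih]

/-- The probability that `f j = k` and `f z ≤ k` whenever `j ≤ z ≤ i`. -/
theorem tsum_rank_eq_and_forall_le {n : ℕ} (i j : Fin n) (hj : j ≤ i) (k : ℕ) :
    ∑' f : Fin n → ℕ, (∏ z, (1 / 2 : ℝ≥0∞) ^ (f z + 1)) *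
        (if f j = k ∧ ∀ z, j ≤ z → z ≤ i → f z ≤ k then 1 else 0) =
      (1 / 2 : ℝ≥0∞) ^ (k + 1) *
        (∑ x ∈ Finset.range (k + 1), (1 / 2 : ℝ≥0∞) ^ (x + 1)) ^ ((i : ℕ) - j) := by
  classical
  set s := ∑ x ∈ Finset.range (k + 1), (1 / 2 : ℝ≥0∞) ^ (x + 1)
  let P : Fin n → ℕ → Prop := fun z x => (z = j → x = k) ∧ (z ∈ Finset.Ioc j i → x ≤ k)
  have hP (f : Fin n → ℕ) :
      (f j = k ∧ ∀ z, j ≤ z → z ≤ i → f z ≤ k) ↔ ∀ z, P z (f z) := by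
    constructor
    · rintro ⟨h, h'⟩ z
      exact ⟨fun e => e ▸ h, fun hz => h' z (Finset.mem_Ioc.1 hz).1.le (Finset.mem_Ioc.1 hz).2⟩
    · intro h
      have hk : f j = k := (h j).1 rfl
      refine ⟨hk, fun z hz hzi => ?_⟩
      rcases hz.eq_or_lt with rfl | hlt
      · exact hk.le
      · exact (h z).2 (Finset.mem_Ioc.2 ⟨hlt, hzi⟩)
  have hsum (z : Fin n) : ∑' x, (1 / 2 : ℝ≥0∞) ^ (x + 1) * (if P z x then 1 else 0) =
      (if z = j then (1 / 2 : ℝ≥0∞) ^ (k + 1) else 1) *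
        (if z ∈ Finset.Ioc j i then s else 1) := by
    by_cases h1 : z = j
    · subst h1
      simp [P, tsum_ite_eq]
    · by_cases h2 : z ∈ Finset.Ioc j i
      · rw [tsum_eq_sum (s := Finset.range (k + 1))]
        · rw [if_neg h1, if_pos h2, one_mul]
          refine Finset.sum_congr rfl fun x hx => ?_
          rw [if_pos ⟨fun e => absurd e h1, fun _ => by simpa [Nat.lt_succ_iff] using hx⟩, mul_one]
        · intro x hx
          rw [if_neg, mul_zero]
          intro h
          exact hx (Finset.mem_range.2 (Nat.lt_succ_of_le (h.2 h2)))
      · rw [if_neg h1, if_neg h2, one_mul]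
        refine (tsum_congr fun x => ?_).trans tsum_half_pow_succ
        rw [if_pos ⟨fun e => absurd e h1, fun e => absurd e h2⟩, mul_one]
  calc _ = ∑' f : Fin n → ℕ,
        ∏ z, ((1 / 2 : ℝ≥0∞) ^ (f z + 1) * (if P z (f z) then 1 else 0)) := by
        refine tsum_congr fun f => ?_
        rw [Finset.prod_mul_distrib, Finset.prod_ite_zero]
        simp [hP]
    _ = _ := by
        rw [ENNReal.tsum_pi_prod n fun z x => (1 / 2 : ℝ≥0∞) ^ (x + 1) * (if P z x then 1 else 0),
          Finset.prod_congr rfl fun z _ => hsum z, Finset.prod_mul_distrib,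
          Finset.prod_ite_eq' Finset.univ j, Finset.prod_ite_mem, Finset.univ_inter,
          Finset.prod_const, Fin.card_Ioc]
        simp

theorem sum_Iic_pow_sub {R : Type*} [CommSemiring R] {n : ℕ} (i : Fin n) (s : R) :
    ∑ j ∈ Finset.Iic i, s ^ ((i : ℕ) - j) = ∑ t ∈ Finset.range (i + 1), s ^ t := by
  rw [← Finset.sum_range_reflect (fun t => s ^ t)]
  refine Finset.sum_bij (fun j _ => (j : ℕ)) ?_ ?_ ?_ ?_
  · intro j hj
    simpa [Nat.lt_succ_iff] using hj
  · intro a _ b _ h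
    exact Fin.ext h
  · intro t ht
    have ht' : t ≤ i := Nat.lt_succ_iff.1 (Finset.mem_range.1 ht)
    exact ⟨⟨t, ht'.trans_lt i.2⟩, by simpa [Fin.le_def] using ht', rfl⟩
  · intro j _
    simp

theorem natCard_eq_sum_tsum {n : ℕ} (i : Fin n) (f : Fin n → ℕ) :
    ((Nat.card {j : Fin n // j ≤ i ∧ ∀ z : Fin n, j ≤ z → z ≤ i → f z ≤ f j} : ℕ) : ℝ≥0∞) =
      ∑ j ∈ Finset.Iic i, ∑' k : ℕ,
        if f j = k ∧ ∀ z, j ≤ z → z ≤ i → f z ≤ k then 1 else 0 := by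
  classical
  rw [Nat.card_eq_fintype_card, Fintype.card_subtype, Finset.card_filter, Nat.cast_sum,
    ← Finset.sum_subset (Finset.subset_univ (Finset.Iic i))]
  · refine Finset.sum_congr rfl fun j hj => ?_
    rw [tsum_eq_single (f j) fun k hk => if_neg fun h => hk h.1.symm]
    simp [Finset.mem_Iic.1 hj]
  · intro j _ hj
    simp [mt Finset.mem_Iic.2 hj]

/-- Splitting the series at `K`. -/
theorem tsum_le_add_mul_half_pow {a : ℕ → ℝ≥0∞} {c : ℝ≥0∞} (h1 : ∀ k, a k ≤ 1)
    (hc : ∀ k, a k ≤ c * (1 / 2) ^ (k + 1)) (K : ℕ) :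
    ∑' k, a k ≤ K + c * (1 / 2) ^ K := by
  rw [← ENNReal.summable.sum_add_tsum_nat_add' (k := K)]
  refine add_le_add ((Finset.sum_le_sum fun k _ => h1 k).trans (by simp)) ?_
  calc ∑' k, a (k + K) ≤ ∑' k : ℕ, c * (1 / 2) ^ K * (1 / 2) ^ (k + 1) :=
        ENNReal.tsum_le_tsum fun k => (hc _).trans_eq (by ring)
    _ = _ := by rw [ENNReal.tsum_mul_left, tsum_half_pow_succ, mul_one]

/-- **Expected number of low ancestors.** Let `r : Fin n → ℕ` be independent geometric
random variables with `P(r i = k) = 1/2^(k+1)` (modelled by the product PMF `μ`), and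
`n ≥ 2`. For every index `i`, the expected number of indices `j ≤ i` such that
`r j ≥ r z` for all `z` with `j ≤ z ≤ i` is at most `lg n + 3`. -/
theorem expected_low_ancestors (n : ℕ) (hn : 2 ≤ n)
    (μ : PMF (Fin n → ℕ))
    (hμ : ∀ f : Fin n → ℕ, μ f = ∏ j : Fin n, (1 / 2 : ℝ≥0∞) ^ (f j + 1))
    (i : Fin n) :
    ∑' f : Fin n → ℕ,
        μ f * ((Nat.card {j : Fin n // j ≤ i ∧
            ∀ z : Fin n, j ≤ z → z ≤ i → f z ≤ f j} : ℕ) : ℝ≥0∞) ≤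
      ENNReal.ofReal (Real.logb 2 n + 3) := by
  let s : ℕ → ℝ≥0∞ := fun k => ∑ x ∈ Finset.range (k + 1), (1 / 2 : ℝ≥0∞) ^ (x + 1)
  have hqs (k : ℕ) : (1 / 2 : ℝ≥0∞) ^ (k + 1) + s k = 1 := half_pow_add_sum_range (k + 1)
  calc _ = ∑' k : ℕ, (1 / 2 : ℝ≥0∞) ^ (k + 1) * ∑ t ∈ Finset.range (i + 1), s k ^ t := by
        simp_rw [natCard_eq_sum_tsum, hμ, Finset.mul_sum, ← ENNReal.tsum_mul_left]
        rw [Summable.tsum_finsetSum fun _ _ => ENNReal.summable]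
        simp_rw [← Finset.mul_sum, ← sum_Iic_pow_sub, Finset.mul_sum]
        rw [Summable.tsum_finsetSum fun _ _ => ENNReal.summable]
        refine Finset.sum_congr rfl fun j hj => ?_
        rw [ENNReal.tsum_comm]
        exact tsum_congr fun k => tsum_rank_eq_and_forall_le i j (Finset.mem_Iic.1 hj) k
    _ ≤ (Nat.log 2 n + 1 : ℕ) + n * (1 / 2) ^ (Nat.log 2 n + 1) := by
        refine tsum_le_add_mul_half_pow (fun k => ?_) (fun k => ?_) _
        · exact le_self_add.trans (mul_sum_pow_add_pow (hqs k) _).le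
        · rw [mul_comm]
          gcongr
          have hs : s k ≤ 1 := le_add_self.trans (hqs k).le
          calc ∑ t ∈ Finset.range (i + 1), s k ^ t ≤ ∑ t ∈ Finset.range (i + 1), 1 :=
                Finset.sum_le_sum fun t _ => pow_le_one' hs t
            _ ≤ n := by
                rw [Finset.sum_const, Finset.card_range, nsmul_one]
                exact_mod_cast i.2
    _ ≤ (Nat.log 2 n + 1 : ℕ) + 1 := by
        gcongr
        have h : (n : ℝ≥0∞) ≤ 2 ^ (Nat.log 2 n + 1) := by
          exact_mod_cast (Nat.lt_pow_succ_log_self one_lt_two n).le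
        calc (n : ℝ≥0∞) * (1 / 2) ^ (Nat.log 2 n + 1)
            ≤ 2 ^ (Nat.log 2 n + 1) * (1 / 2) ^ (Nat.log 2 n + 1) := by gcongr
          _ = 1 := by
            rw [← mul_pow, one_div, ENNReal.mul_inv_cancel (by simp) (by simp), one_pow]
    _ = ENNReal.ofReal (Nat.log 2 n + 2 : ℕ) := by
        rw [ENNReal.ofReal_natCast]
        push_cast
        ring
    _ ≤ _ := by
        apply ENNReal.ofReal_le_ofReal
        have := Real.natLog_le_logb n 2
        push_cast at this ⊢
        linarith
end

section
/- There exist constants a > 0 and c > 1, independent of k and n, such that the following holds: let i be a fixed index in Fin n, let the ranks r(j) for j ≠ i be independent geometric random variables with P(r(j) = m) = 1/2^{m+1}, let r(i) be any fixed value at most k, and let T(r) be the (unique) zip tree on nodes with keys 0, …, n−1 and ranks r. Then the probability that the total number of nodes on the right spine of the left subtree of node i together with the left spine of the right subtree of node i exceeds a·k is at most 1/(2·c^k). -/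
open scoped ENNReal

namespace ZTree

/-- Scanning a list of ranks with current maximum `s`, the number of entries that are at least
all the entries before them and `s`, up to the first entry that is at least `v`. -/
def recordCount (v : ℕ) : ℕ → List ℕ → ℕ
  | _, [] => 0
  | s, m :: l =>
      if v ≤ m then 0
      else if m < s then recordCount v s l
      else recordCount v m l + 1

lemma recordCount_append_of_lt {v s : ℕ} {l : List ℕ} (hl : ∀ m ∈ l, m < s) (hs : s ≤ v)
    (l' : List ℕ) : recordCount v s (l ++ l') = recordCount v s l' := by
  induction l with
  | nil => rfl
  | cons m l ih =>
    have hm : m < s := hl m (by simp)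
    rw [List.cons_append, recordCount, if_neg (by omega), if_pos hm]
    exact ih fun x hx => hl x (by simp [hx])

lemma recordCount_of_le {v s : ℕ} (h : v ≤ s) (l : List ℕ) : recordCount v s l = 0 := by
  induction l with
  | nil => rfl
  | cons m l ih =>
    rw [recordCount]
    split_ifs with h1 h2
    · rfl
    · exact ih
    · omega

section
variable {α : Type}

lemma rank_le_of_rootRank_le {t : ZTree α} (ht : t.isRankHeap) {b : ℕ}
    (hb : ∀ m ∈ t.rootRank?, m ≤ b) : ∀ p ∈ t.nodes, p.2 ≤ b := by
  induction t generalizing b with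
  | leaf => simp [nodes]
  | node l k m r ihl ihr =>
    obtain ⟨hl, hr, htl, htr⟩ := ht
    have hm : m ≤ b := hb m (by simp [rootRank?])
    intro p hp
    simp only [nodes, List.mem_append, List.mem_cons] at hp
    rcases hp with hp | rfl | hp
    · exact ihl htl (fun x hx => ((hl x hx).le.trans hm)) p hp
    · exact hm
    · exact ihr htr (fun x hx => (hr x hx).trans hm) p hp

lemma rank_lt_of_rootRank_lt {t : ZTree α} (ht : t.isRankHeap) {b : ℕ}
    (hb : ∀ m ∈ t.rootRank?, m < b) : ∀ p ∈ t.nodes, p.2 < b := by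
  cases b with
  | zero =>
    cases t with
    | leaf => simp [nodes]
    | node l k m r => exact absurd (hb m (by simp [rootRank?])) (by omega)
  | succ b =>
    intro p hp
    have := rank_le_of_rootRank_le ht (b := b) (fun m hm => Nat.lt_succ_iff.1 (hb m hm)) p hp
    omega

lemma leftSpineLen_le {t : ZTree α} (ht : t.isRankHeap) {b : ℕ}
    (hb : ∀ m ∈ t.rootRank?, m < b) : t.leftSpineLen ≤ b := by
  induction t generalizing b with
  | leaf => simp [leftSpineLen]
  | node l k m r ihl ihr =>
    have hm : m < b := hb m (by simp [rootRank?])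
    have := ihl ht.2.2.1 ht.1
    simp only [leftSpineLen]
    omega

lemma exists_rightSpineLen_add_le {t : ZTree α} (ht : t.isRankHeap) {v b : ℕ} (hbv : b < v)
    (hb : ∀ m ∈ t.rootRank?, m ≤ b) :
    ∃ s ≤ b, ∀ l' : List ℕ, t.rightSpineLen + recordCount v s l' ≤
      recordCount v 0 ((t.nodes.map Prod.snd).reverse ++ l') := by
  induction t generalizing b with
  | leaf => exact ⟨0, by simp, by simp [rightSpineLen, nodes]⟩
  | node l k m r ihl ihr =>
    obtain ⟨hl, hr, htl, htr⟩ := ht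
    have hm : m ≤ b := hb m (by simp [rootRank?])
    obtain ⟨s, hs, h⟩ := ihr htr (hm.trans_lt hbv) hr
    refine ⟨m, hm, fun l' => ?_⟩
    have h1 := h (m :: ((l.nodes.map Prod.snd).reverse ++ l'))
    rw [recordCount, if_neg (by omega), if_neg (by omega), recordCount_append_of_lt _ (by omega)]
      at h1
    · simp only [rightSpineLen, nodes, List.map_append, List.map_cons, List.reverse_append,
        List.reverse_cons, List.append_assoc, List.cons_append, List.nil_append] at h1 ⊢
      omega
    · have := rank_lt_of_rootRank_lt htl hl
      simpa using fun x y hxy => this (y, x) hxy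

lemma rightSpineLen_le_recordCount {t : ZTree α} (ht : t.isRankHeap) {v : ℕ}
    (hv : ∀ m ∈ t.rootRank?, m < v) (l' : List ℕ) :
    t.rightSpineLen ≤ recordCount v 0 ((t.nodes.map Prod.snd).reverse ++ l') := by
  cases v with
  | zero =>
    cases t with
    | leaf => simp [rightSpineLen]
    | node l k m r => exact absurd (hv m (by simp [rootRank?])) (by omega)
  | succ b =>
    obtain ⟨s, -, h⟩ := exists_rightSpineLen_add_le ht b.lt_succ_self
      fun m hm => Nat.lt_succ_iff.1 (hv m hm)
    exact le_trans (Nat.le_add_right _ _) (h l')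

end

section
variable {α : Type} [LinearOrder α]

lemma isBST.pairwise_nodes {t : ZTree α} (ht : t.isBST) :
    t.nodes.Pairwise fun p q => p.1 < q.1 := by
  induction t with
  | leaf => simp [nodes]
  | node l k m r ihl ihr =>
    obtain ⟨hl, hr, htl, htr⟩ := ht
    simp only [nodes, List.pairwise_append, List.pairwise_cons, List.mem_cons]
    refine ⟨ihl htl, ⟨hr, ihr htr⟩, ?_⟩
    rintro p hp q (rfl | hq)
    · exact hl p hp
    · exact (hl p hp).trans (hr q hq)

lemma isZipTree.subtreeAt_eq {t : ZTree α} (ht : t.isZipTree) {a : α} {v : ℕ}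
    (ha : (a, v) ∈ t.nodes) :
    ∃ l r : ZTree α, t.subtreeAt a = .node l a v r ∧ (ZTree.node l a v r).isRankHeap ∧
      ∃ X Y, t.nodes = X ++ (ZTree.node l a v r).nodes ++ Y := by
  obtain ⟨hB, hH⟩ := ht
  induction t with
  | leaf => simp [nodes] at ha
  | node l k m r ihl ihr =>
    obtain ⟨hl, hr, hBl, hBr⟩ := hB
    simp only [nodes, List.mem_append, List.mem_cons] at ha
    rcases ha with ha | ha | ha
    · have hk : a < k := hl _ ha
      obtain ⟨l', r', h1, h2, X, Y, h3⟩ := ihl ha hBl hH.2.2.1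
      exact ⟨l', r', by rw [subtreeAt, if_pos hk, h1], h2, X, Y ++ (k, m) :: r.nodes,
        by rw [nodes, h3]; simp⟩
    · obtain ⟨rfl, rfl⟩ := Prod.mk.inj ha
      exact ⟨l, r, by simp [subtreeAt], hH, [], [], by simp⟩
    · have hk : k < a := hr _ ha
      obtain ⟨l', r', h1, h2, X, Y, h3⟩ := ihr ha hBr hH.2.2.2
      exact ⟨l', r', by rw [subtreeAt, if_neg hk.not_gt, if_pos hk, h1], h2,
        l.nodes ++ (k, m) :: X, Y, by rw [nodes, h3]; simp⟩

/-- The nodes zipped when deleting `a` consist of at most `recordCount` nodes with smaller key,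
at most `v` + 1 nodes with larger key, and none of the latter if the successor of `a` has rank
greater than `v`. -/
lemma isZipTree.zipSpineCount_le {t : ZTree α} (ht : t.isZipTree) {a : α} {v : ℕ}
    (ha : (a, v) ∈ t.nodes) :
    ∃ d, t.zipSpineCount a ≤
        recordCount v 0 ((t.nodes.filter (·.1 < a)).map Prod.snd).reverse + d ∧ d ≤ v + 1 ∧
      (d ≠ 0 → ∃ p ∈ t.nodes, a < p.1 ∧
        ∀ q ∈ t.nodes, a < q.1 → q.1 ≤ p.1 → q.2 ≤ v) := by
  obtain ⟨l, r, h1, ⟨hl, hr, hHl, hHr⟩, X, Y, h2⟩ := ht.subtreeAt_eq ha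
  have hp := ht.1.pairwise_nodes
  rw [h2] at hp
  simp only [nodes, List.pairwise_append, List.pairwise_cons, List.mem_append, List.mem_cons]
    at hp
  obtain ⟨⟨-, ⟨-, ⟨hra, -⟩, hla⟩, hX⟩, -, hY⟩ := hp
  have hf : t.nodes.filter (·.1 < a) = X ++ l.nodes := by
    rw [h2]
    simp only [nodes, List.filter_append, List.filter_cons, lt_irrefl, decide_false]
    have e1 : X.filter (·.1 < a) = X := List.filter_eq_self.2 fun p hp => by
      simpa using hX p hp (a, v) (by simp)
    have e2 : l.nodes.filter (·.1 < a) = l.nodes := List.filter_eq_self.2 fun p hp => by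
      simpa using hla p hp (a, v) (by simp)
    have e3 : r.nodes.filter (·.1 < a) = [] := List.filter_eq_nil_iff.2 fun p hp => by
      simpa using (hra p hp).le
    have e4 : Y.filter (·.1 < a) = [] := List.filter_eq_nil_iff.2 fun p hp => by
      simpa using (hY (a, v) (by simp) p hp).le
    simp [e1, e2, e3, e4]
  refine ⟨r.leftSpineLen, ?_, leftSpineLen_le hHr fun m hm => Nat.lt_succ_iff.2 (hr m hm), ?_⟩
  · have := rightSpineLen_le_recordCount hHl hl (X.map Prod.snd).reverse
    rw [zipSpineCount, h1, hf, List.map_append, List.reverse_append]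
    exact Nat.add_le_add_right this _
  · intro hd
    have hne : r.nodes ≠ [] := by
      cases r with
      | leaf => simp [leftSpineLen] at hd
      | node => simp [nodes]
    obtain ⟨p, hp⟩ := List.exists_mem_of_ne_nil _ hne
    refine ⟨p, by rw [h2]; simp [nodes, hp], hra p hp, fun q hq haq hqp => ?_⟩
    rw [h2] at hq
    simp only [nodes, List.mem_append, List.mem_cons] at hq
    rcases hq with (hq | hq | rfl | hq) | hq
    · exact absurd (hX q hq (a, v) (by simp)) haq.not_gt
    · exact absurd (hla q hq (a, v) (by simp)) haq.not_gt
    · exact absurd haq (lt_irrefl _)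
    · exact rank_le_of_rootRank_le hHr hr q hq
    · exact absurd (hY p (by simp [hp]) q hq) hqp.not_gt

end

end ZTree

lemma tsum_geometric_weight : ∑' m : ℕ, (1 / 2 : ℝ≥0∞) ^ (m + 1) = 1 := by
  rw [ENNReal.tsum_geometric_add_one, one_div, ENNReal.one_sub_inv_two,
    ENNReal.mul_inv_cancel (by simp) (by simp)]

/-- Independence of one coordinate from the others under a product of geometric weights. -/
lemma tsum_prod_geometric_resample {ι : Type*} [Fintype ι] [DecidableEq ι] (a : ι)
    (H : ℕ → (ι → ℕ) → ℝ≥0∞) (hH : ∀ m g x, H m (Function.update g a x) = H m g) :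
    ∑' g : ι → ℕ, (∏ j, (1 / 2 : ℝ≥0∞) ^ (g j + 1)) * H (g a) g =
      ∑' m : ℕ, (1 / 2 : ℝ≥0∞) ^ (m + 1) *
        ∑' g : ι → ℕ, (∏ j, (1 / 2 : ℝ≥0∞) ^ (g j + 1)) * H m g := by
  let e := (Equiv.funSplitAt a ℕ).symm
  have ea : ∀ p, e p a = p.1 := fun p => by simp [e, Equiv.funSplitAt, Equiv.piSplitAt]
  have ene : ∀ p (j : {j // j ≠ a}), e p j = p.2 j := fun p j => by
    simp [e, Equiv.funSplitAt, Equiv.piSplitAt, j.2]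
  have hw : ∀ p, ∏ j, (1 / 2 : ℝ≥0∞) ^ (e p j + 1) =
      (1 / 2 : ℝ≥0∞) ^ (p.1 + 1) * ∏ j : {j // j ≠ a}, (1 / 2 : ℝ≥0∞) ^ (p.2 j + 1) := by
    intro p
    rw [Fintype.prod_eq_mul_prod_subtype_ne _ a, ea]
    simp_rw [ene]
  have hK : ∀ m p, H m (e p) = H m (e (0, p.2)) := by
    intro m p
    rw [← hH m (e p) 0]
    congr 1
    ext j
    by_cases hj : j = a
    · subst hj; simp [ea]
    · rw [Function.update_of_ne hj, ene p ⟨j, hj⟩, ene (0, p.2) ⟨j, hj⟩]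
  have key : ∀ F : ℕ → ({j // j ≠ a} → ℕ) → ℝ≥0∞,
      ∑' p : ℕ × ({j // j ≠ a} → ℕ), ((1 / 2 : ℝ≥0∞) ^ (p.1 + 1) *
        ∏ j : {j // j ≠ a}, (1 / 2 : ℝ≥0∞) ^ (p.2 j + 1)) * F p.1 p.2 =
      ∑' m : ℕ, (1 / 2 : ℝ≥0∞) ^ (m + 1) * ∑' h : {j // j ≠ a} → ℕ,
        (∏ j : {j // j ≠ a}, (1 / 2 : ℝ≥0∞) ^ (h j + 1)) * F m h := by
    intro F
    rw [ENNReal.tsum_prod']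
    simp_rw [mul_assoc, ENNReal.tsum_mul_left]
  rw [← e.tsum_eq]
  simp_rw [fun m : ℕ => (e.tsum_eq fun g => (∏ j, (1 / 2 : ℝ≥0∞) ^ (g j + 1)) * H m g).symm,
    hw, ea]
  rw [tsum_congr fun p => by rw [hK], key fun m h => H m (e (0, h))]
  refine tsum_congr fun m => ?_
  have h2 := key fun _ h => H m (e (0, h))
  simp_rw [← hK] at h2
  rw [h2, ENNReal.tsum_mul_right,
    tsum_geometric_weight, one_mul]

lemma tsum_geometric_record_weight (s : ℕ) :
    ∑' m : ℕ, (1 / 2 : ℝ≥0∞) ^ (m + 1) *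
      (if m < s then 1 else if m = s then 4 / 3 else 2 / 3) = 1 := by
  induction s with
  | zero =>
    rw [tsum_eq_zero_add' ENNReal.summable]
    simp only [lt_irrefl, if_false, if_true, Nat.not_lt_zero, Nat.succ_ne_zero]
    simp_rw [pow_succ _ (_ + 1), mul_assoc]
    rw [ENNReal.tsum_mul_right, tsum_geometric_weight]
    rw [← ENNReal.toReal_eq_one_iff, ENNReal.toReal_add] <;>
      simp [ENNReal.toReal_mul, ENNReal.mul_eq_top, ENNReal.div_eq_top]
    norm_num
  | succ s ih =>
    rw [tsum_eq_zero_add' ENNReal.summable]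
    simp only [Nat.succ_pos, if_true, add_lt_add_iff_right, add_left_inj]
    simp_rw [pow_succ' _ (_ + 1), mul_assoc]
    rw [ENNReal.tsum_mul_left, ih]
    simp [ENNReal.inv_two_add_inv_two]

open ZTree in
/-- Exponential moment bound for the number of records below `v` in a sequence of independent
geometric ranks. -/
lemma tsum_recordCount_le {ι : Type*} [Fintype ι] [DecidableEq ι]
    (h1 : ∑' g : ι → ℕ, ∏ j, (1 / 2 : ℝ≥0∞) ^ (g j + 1) = 1) (v : ℕ) {l : List ι}
    (hl : l.Nodup) (s : ℕ) :
    ∑' g : ι → ℕ, (∏ j, (1 / 2 : ℝ≥0∞) ^ (g j + 1)) *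
      (4 / 3 : ℝ≥0∞) ^ recordCount v s (l.map g) ≤ 2 ^ (v - s) := by
  induction l generalizing s with
  | nil => simpa [recordCount] using h1.le.trans (one_le_pow₀ one_le_two)
  | cons a l ih =>
    rcases le_or_gt v s with hvs | hvs
    · simpa only [recordCount_of_le hvs, pow_zero, mul_one] using
        h1.le.trans (one_le_pow₀ one_le_two)
    obtain ⟨ha, hl⟩ := List.nodup_cons.1 hl
    have := tsum_prod_geometric_resample a
      (fun m g => (4 / 3 : ℝ≥0∞) ^ recordCount v s (m :: l.map g)) (by
        intro m g x
        congr 3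
        refine List.map_congr_left fun j hj => Function.update_of_ne ?_ _ _
        rintro rfl
        exact ha hj)
    simp only [List.map_cons]
    rw [this]
    have hsum := congrArg (· * (2 : ℝ≥0∞) ^ (v - s)) (tsum_geometric_record_weight s)
    simp only [← ENNReal.tsum_mul_right, one_mul] at hsum
    rw [← hsum]
    refine ENNReal.tsum_le_tsum fun m => ?_
    rw [mul_assoc]
    refine mul_le_mul' le_rfl ?_
    have h43 : (2 / 3 : ℝ≥0∞) * 2 = 4 / 3 := by
      rw [← ENNReal.mul_div_right_comm]; norm_num
    by_cases hvm : v ≤ m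
    · rw [if_neg (by omega), if_neg (by omega)]
      simp only [recordCount, if_pos hvm, pow_zero, mul_one, h1]
      obtain ⟨d, hd⟩ : ∃ d, v - s = d + 1 := ⟨v - s - 1, by omega⟩
      rw [hd, pow_succ', ← mul_assoc, h43]
      refine one_le_mul ?_ (one_le_pow₀ one_le_two)
      rw [ENNReal.le_div_iff_mul_le (by simp) (by simp)]
      norm_num
    by_cases hms : m < s
    · simpa only [recordCount, if_neg hvm, if_pos hms, one_mul] using ih hl s
    · simp only [recordCount, if_neg hvm, if_neg hms, pow_succ (4 / 3 : ℝ≥0∞), ← mul_assoc,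
        ENNReal.tsum_mul_right]
      refine (mul_le_mul_left (ih hl m) _).trans ?_
      rw [mul_comm]
      split_ifs with hs
      · rw [hs]
      · rw [← h43, mul_assoc, ← pow_succ']
        gcongr
        · exact one_le_two
        · omega

/-- **Number of nodes on the unzipped/zipped paths, high-probability part
(Theorem 3).** There are constants `a > 0` and `c > 1`, independent of `k` and `n`,
such that: for a fixed index `i` of `Fin n`, independent geometric ranks
`r j` (`j ≠ i`) with `P(r j = m) = 1/2^(m+1)` (modelled by the product PMF `μ` on
`{j // j ≠ i} → ℕ`), a fixed rank `v ≤ k` for node `i`, and `T g` the (unique) zip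
tree on keys `0, …, n−1` with these ranks, the probability that the total number of
nodes on the right spine of the left subtree of node `i` together with the left
spine of the right subtree of node `i` exceeds `a·k` is at most `1/(2·c^k)`. -/
theorem zip_path_nodes_high_prob :
    ∃ a : ℝ, 0 < a ∧ ∃ c : ℝ, 1 < c ∧
      ∀ (n k : ℕ) (i : Fin n) (v : ℕ), v ≤ k →
      ∀ (μ : PMF (({j : Fin n // j ≠ i}) → ℕ)),
        (∀ g : {j : Fin n // j ≠ i} → ℕ,
          μ g = ∏ j : {j : Fin n // j ≠ i}, (1 / 2 : ℝ≥0∞) ^ (g j + 1)) →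
      ∀ (T : ({j : Fin n // j ≠ i} → ℕ) → ZTree ℕ),
        (∀ g : {j : Fin n // j ≠ i} → ℕ, (T g).isZipTree ∧
          (T g).nodes.Perm ((List.finRange n).map
            fun j : Fin n => ((j : ℕ), if h : j = i then v else g ⟨j, h⟩))) →
        μ.toOuterMeasure {g : {j : Fin n // j ≠ i} → ℕ |
            a * (k : ℝ) < (((T g).zipSpineCount (i : ℕ) : ℕ) : ℝ)} ≤
          ENNReal.ofReal (1 / (2 * c ^ k)) := by
  refine ⟨10, by norm_num, 2, by norm_num, fun n k i v hv μ hμ T hT => ?_⟩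
  have h1 : ∑' g : {j : Fin n // j ≠ i} → ℕ, ∏ j, (1 / 2 : ℝ≥0∞) ^ (g j + 1) = 1 := by
    simp_rw [← hμ]
    exact μ.tsum_coe
  let ls : List {j : Fin n // j ≠ i} :=
    (List.finRange n).filterMap fun j => if h : j < i then some ⟨j, h.ne⟩ else none
  have hls : ls.Nodup := by
    refine (List.nodup_finRange n).filterMap fun a a' b hb hb' => ?_
    split_ifs at hb hb' <;> simp_all
    rw [← hb] at hb'
    exact (Subtype.ext_iff.1 hb').symm
  have hcount : ∀ g, ∃ d, (T g).zipSpineCount (i : ℕ) ≤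
      ZTree.recordCount v 0 (ls.reverse.map g) + d ∧ d ≤ v + 1 ∧
        (d ≠ 0 → ∃ h : (i : ℕ) + 1 < n, g ⟨⟨i + 1, h⟩, by simp [Fin.ext_iff]⟩ ≤ v) := by
    intro g
    obtain ⟨hz, hp⟩ := hT g
    have hmem : ∀ p, p ∈ (T g).nodes ↔
        ∃ j : Fin n, ((j : ℕ), if h : j = i then v else g ⟨j, h⟩) = p := fun p => by
      rw [hp.mem_iff]; simp
    have hnodes := hp.eq_of_pairwise (fun a b _ _ h h' => absurd h' h.not_gt)
      hz.1.pairwise_nodes (by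
        rw [List.pairwise_map]
        exact List.pairwise_lt_finRange n)
    have hleft : ((T g).nodes.filter (·.1 < (i : ℕ))).map Prod.snd = ls.map g := by
      rw [hnodes, List.filter_map, List.map_map, ← List.filterMap_eq_filter, List.map_filterMap,
        List.map_filterMap]
      refine List.filterMap_congr fun j _ => ?_
      by_cases hj : j < i
      · simp [hj, hj.ne, Option.guard]
      · simp [hj, Option.guard]
    obtain ⟨d, hd, hdv, hd0⟩ := hz.zipSpineCount_le ((hmem (i, v)).2 ⟨i, by simp⟩)
    refine ⟨d, by rwa [hleft, ← List.map_reverse] at hd, hdv, fun h => ?_⟩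
    obtain ⟨p, hpm, hip, hle⟩ := hd0 h
    obtain ⟨j, rfl⟩ := (hmem p).1 hpm
    have hj : (i : ℕ) + 1 < n := lt_of_le_of_lt hip j.2
    refine ⟨hj, ?_⟩
    have := hle _ ((hmem _).2 ⟨⟨i + 1, hj⟩, rfl⟩) (Nat.lt_succ_self _) hip
    simpa [Fin.ext_iff] using this
  rw [PMF.toOuterMeasure_apply]
  rcases Nat.eq_zero_or_pos k with rfl | hk
  · obtain rfl : v = 0 := by omega
    have hpos : ∀ g, 0 < (T g).zipSpineCount (i : ℕ) →
        ∃ h : (i : ℕ) + 1 < n, g ⟨⟨i + 1, h⟩, by simp [Fin.ext_iff]⟩ = 0 := by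
      intro g hg
      obtain ⟨d, hd, -, hd0⟩ := hcount g
      rw [ZTree.recordCount_of_le le_rfl] at hd
      simpa using hd0 (by omega)
    by_cases hn : (i : ℕ) + 1 < n
    · let a : {j : Fin n // j ≠ i} := ⟨⟨i + 1, hn⟩, by simp [Fin.ext_iff]⟩
      have h2 := tsum_prod_geometric_resample a (fun m _ => if m = 0 then 1 else 0)
        fun _ _ _ => rfl
      simp_rw [ENNReal.tsum_mul_right, h1] at h2
      rw [tsum_eq_single (f := fun m : ℕ => (1 / 2 : ℝ≥0∞) ^ (m + 1) * _) 0
        (by simp +contextual)] at h2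
      have h3 : ENNReal.ofReal (1 / (2 * 2 ^ 0)) = 1 / 2 := by
        rw [ENNReal.ofReal_div_of_pos (by norm_num)]; simp
      rw [h3]
      refine le_trans (ENNReal.tsum_le_tsum fun g => ?_) (h2.le.trans (by simp))
      refine Set.indicator_apply_le' (fun hg => ?_) fun _ => zero_le
      obtain ⟨_, h⟩ := hpos g (by simpa using hg)
      rw [if_pos h, hμ, mul_one]
    · refine le_trans (le_of_eq ?_) zero_le
      refine ENNReal.tsum_eq_zero.2 fun g => Set.indicator_of_notMem (fun hg => ?_) _
      exact hn (hpos g (by simpa using hg)).1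
  · have hM := tsum_recordCount_le h1 v (List.nodup_reverse.2 hls) 0
    have h8 : (8 : ℝ≥0∞) ≤ (4 / 3) ^ 8 := by
      rw [div_eq_mul_inv, mul_pow, ← ENNReal.inv_pow, ← div_eq_mul_inv,
        ENNReal.le_div_iff_mul_le (by simp) (by simp)]
      norm_num
    have h43 : (1 : ℝ≥0∞) ≤ 4 / 3 := by
      rw [ENNReal.le_div_iff_mul_le (by simp) (by simp)]
      norm_num
    have hS : (∑' g, {g : {j : Fin n // j ≠ i} → ℕ |
        10 * (k : ℝ) < (((T g).zipSpineCount (i : ℕ) : ℕ) : ℝ)}.indicator μ g) * 8 ^ k ≤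
          2 ^ k := by
      rw [← ENNReal.tsum_mul_right]
      refine (ENNReal.tsum_le_tsum fun g => ?_).trans
        (hM.trans (pow_le_pow_right₀ one_le_two hv))
      by_cases hg : 10 * (k : ℝ) < (((T g).zipSpineCount (i : ℕ) : ℕ) : ℝ)
      · rw [Set.indicator_of_mem (by exact hg), hμ]
        obtain ⟨d, hd, hdv, -⟩ := hcount g
        have hg' : 10 * k < (T g).zipSpineCount (i : ℕ) := by exact_mod_cast hg
        refine mul_le_mul' le_rfl ?_
        calc (8 : ℝ≥0∞) ^ k ≤ ((4 / 3) ^ 8) ^ k := by gcongr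
          _ = (4 / 3) ^ (8 * k) := (pow_mul _ _ _).symm
          _ ≤ _ := pow_le_pow_right₀ h43 (by omega)
      · rw [Set.indicator_of_notMem (by exact hg), zero_mul]
        exact zero_le
    refine (ENNReal.le_div_iff_mul_le (by simp) (by simp)).2 hS |>.trans ?_
    rw [← ENNReal.ofReal_ofNat 8, ← ENNReal.ofReal_ofNat 2, ← ENNReal.ofReal_pow (by norm_num),
      ← ENNReal.ofReal_pow (by norm_num), ← ENNReal.ofReal_div_of_pos (by positivity)]
    refine ENNReal.ofReal_le_ofReal ?_
    rw [div_le_div_iff₀ (by positivity) (by positivity)]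
    have h2k : (2 : ℝ) ≤ 2 ^ k := le_self_pow₀ one_le_two hk.ne'
    have : (8 : ℝ) ^ k = 2 ^ k * 2 ^ k * 2 ^ k := by
      rw [← mul_pow, ← mul_pow]; norm_num
    rw [this]
    nlinarith [mul_le_mul_of_nonneg_right h2k (by positivity : (0 : ℝ) ≤ 2 ^ k * 2 ^ k)]
end
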